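/- arXiv:1006.2720 — 3 statements merged into one kernel-verified Lean document; each statement's English description precedes it below -/
import Mathlib

section
/- Let k be a perfect field of characteristic p, 𝔖 = W(k)[[x_1,…,x_r]], J ⊆ 𝔖 the ideal generated by the variables, σ : 𝔖 → 𝔖 a ring endomorphism with σ(a) − a^p ∈ p·𝔖 for all a ∈ 𝔖 and σ(J) ⊆ J, and E ∈ 𝔖 with E − p ∈ J. Let R = 𝔖/E𝔖, let δ : 𝔖 → W(𝔖) be a ring homomorphism satisfying w_n ∘ δ = σ^n for all n ≥ 0, and let κ : 𝔖 → W(R) be the composite of δ with the map W(𝔖) → W(R) induced by the projection 𝔖 → R. Then κ(E) has zeroth coefficient 0, the element u ∈ W(R) with v(u) = κ(E) is unique, u is a unit of W(R), and κ(E·x) = v(u·κ(σ(x))) for all x ∈ 𝔖. -/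
namespace WittVector

variable {p : ℕ} [hp : Fact p.Prime] {R : Type*} [CommRing R]

theorem ghostComponent_eq_sum (n : ℕ) (x : WittVector p R) :
    ghostComponent n x = ∑ i ∈ Finset.range (n + 1), (p : R) ^ i * x.coeff i ^ p ^ (n - i) := by
  rw [ghostComponent_apply, aeval_wittPolynomial]

theorem ghostComponent_zero_eq_coeff (x : WittVector p R) : ghostComponent 0 x = x.coeff 0 := by
  simp [ghostComponent_eq_sum]

theorem ghostComponent_iterate_frobenius (m n : ℕ) (x : WittVector p R) :
    ghostComponent n (frobenius^[m] x) = ghostComponent (n + m) x := by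
  induction m generalizing n with
  | zero => rfl
  | succ m ih =>
    rw [Function.iterate_succ_apply', ghostComponent_frobenius, ih, add_right_comm, add_assoc]

/-- If `p` is a nonzero element of a domain, Witt vectors are determined by their ghost
components. -/
theorem ext_ghostComponent [IsDomain R] (hpR : (p : R) ≠ 0) {x y : WittVector p R}
    (h : ∀ n, ghostComponent n x = ghostComponent n y) : x = y := by
  ext n
  induction n using Nat.strong_induction_on with
  | _ n ih =>
    have hn := h n
    rw [ghostComponent_eq_sum, ghostComponent_eq_sum, Finset.sum_range_succ,
      Finset.sum_range_succ, Finset.sum_congr rfl fun i hi => by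
        rw [ih i (Finset.mem_range.mp hi)]] at hn
    simpa [hpR] using hn

theorem exists_mul_eq_one_add_iterate_verschiebung {a : WittVector p R}
    (ha : ∀ n, IsUnit (ghostComponent n a)) (n : ℕ) :
    ∃ b x : WittVector p R, a * b = 1 + verschiebung^[n] x := by
  induction n with
  | zero => exact ⟨0, -1, by simp⟩
  | succ n ih =>
    obtain ⟨b, x, hb⟩ := ih
    obtain ⟨c, hc⟩ := (ha n).exists_left_inv
    set y : WittVector p R := teichmuller p (-(x.coeff 0 * c)) with hy
    have hzero : (x + y * frobenius^[n] a).coeff 0 = 0 := by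
      rw [← ghostComponent_zero_eq_coeff, map_add, map_mul, ghostComponent_iterate_frobenius,
        hy, ghostComponent_teichmuller, ghostComponent_zero_eq_coeff, zero_add, pow_zero, pow_one]
      linear_combination (-x.coeff 0) * hc
    refine ⟨b + verschiebung^[n] y, (x + y * frobenius^[n] a).shift 1, ?_⟩
    have hV := eq_iterate_verschiebung (x := x + y * frobenius^[n] a) (n := 1)
      fun i hi => by rwa [Nat.lt_one_iff.mp hi]
    rw [Function.iterate_one] at hV
    rw [Function.iterate_succ_apply, ← hV, iterate_map_add, mul_add, hb, mul_comm a,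
      iterate_verschiebung_mul_left, add_assoc]

/-- A Witt vector all of whose ghost components are units is a unit. -/
theorem isUnit_of_isUnit_ghostComponent {a : WittVector p R}
    (ha : ∀ n, IsUnit (ghostComponent n a)) : IsUnit a := by
  choose b x hb using exists_mul_eq_one_add_iterate_verschiebung ha
  have hinv (n m : ℕ) (hnm : n ≤ m) : truncate n a * truncate n (b m) = 1 := by
    have hker : truncate n (verschiebung^[m] (x m)) = 0 :=
      (mem_ker_truncate n _).mpr fun i hi =>
        iterate_verschiebung_coeff_eq_zero _ (hi.trans_le hnm)
    rw [← map_mul, hb, map_add, hker, map_one, add_zero]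
  have hcoh (n m : ℕ) (hnm : n ≤ m) : truncate n (b m) = truncate n (b n) :=
    left_inv_eq_right_inv ((mul_comm _ _).trans (hinv n m hnm)) (hinv n n le_rfl)
  refine IsUnit.of_mul_eq_one (mk p fun n => (b (n + 1)).coeff n) ?_
  have hb' (n : ℕ) : truncate n (mk p fun n => (b (n + 1)).coeff n) = truncate n (b n) := by
    ext i
    have h := congrArg (fun z => z.coeff (Fin.last (i : ℕ))) (hcoh (i + 1) n i.2)
    simpa [coeff_truncate] using h.symm
  ext n
  have h : truncate (n + 1) (a * mk p fun n => (b (n + 1)).coeff n) = truncate (n + 1) 1 := by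
    rw [map_mul, hb', hinv _ _ le_rfl, map_one]
  have h' := congrArg (fun z => z.coeff (Fin.last n)) h
  simpa only [coeff_truncate, Fin.val_last] using h'

/-- If `p` lies in the Jacobson radical, a Witt vector whose zeroth coefficient is a unit is a
unit. -/
theorem isUnit_of_isUnit_coeff_zero (hpR : ∀ x : R, IsUnit (1 + p * x)) {a : WittVector p R}
    (ha : IsUnit (a.coeff 0)) : IsUnit a := by
  refine isUnit_of_isUnit_ghostComponent fun n => ?_
  obtain ⟨c, hc⟩ := (ha.pow (p ^ n)).exists_left_inv
  set s := ∑ i ∈ Finset.range n, (p : R) ^ i * a.coeff (i + 1) ^ p ^ (n - (i + 1)) with hs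
  have h : ghostComponent n a = a.coeff 0 ^ p ^ n * (1 + p * (c * s)) := by
    rw [ghostComponent_eq_sum, Finset.sum_range_succ']
    simp_rw [pow_succ' (p : R), mul_assoc (p : R)]
    rw [← Finset.mul_sum, ← hs]
    simp only [pow_zero, one_mul, Nat.sub_zero]
    linear_combination (-(p : R) * s) * hc
  rw [h]
  exact (ha.pow _).mul (hpR _)

theorem isUnit_one_add_p_mul {k : Type*} [CommRing k] [CharP k p] (x : WittVector p k) :
    IsUnit (1 + p * x) := by
  refine isUnit_of_isUnit_coeff_zero (fun y => by simp) ?_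
  rw [← ghostComponent_zero_eq_coeff]
  simp

end WittVector

namespace MvPowerSeries

theorem constantCoeff_eq_zero_of_mem_span_X {ι A : Type*} [CommRing A] {a : MvPowerSeries ι A}
    (ha : a ∈ Ideal.span (Set.range (X : ι → MvPowerSeries ι A))) : constantCoeff a = 0 := by
  suffices h : Ideal.span (Set.range (X : ι → MvPowerSeries ι A)) ≤
      RingHom.ker (constantCoeff (σ := ι) (R := A)) from h ha
  rw [Ideal.span_le]
  rintro _ ⟨i, rfl⟩
  simp

end MvPowerSeries

open WittVector in
/-- With `𝔖 = W(k)[[x_1,…,x_r]]`, a Frobenius lift `σ`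
preserving the ideal `J` of the variables, `E ∈ 𝔖` with `E − p ∈ J`,
`R = 𝔖/E𝔖`, `δ : 𝔖 → W(𝔖)` the unique homomorphism with `w_n ∘ δ = σ^n`, and
`κ : 𝔖 → W(R)` the composite of `δ` with the projection:
`κ(E)` has zeroth coefficient `0`, the element `u` with `v(u) = κ(E)` is
unique, `u` is a unit, and `κ(E·x) = v(u·κ(σ(x)))` for all `x`. -/
theorem kappa_E_verschiebung_unit (p : ℕ) [Fact p.Prime]
    (k : Type*) [Field k] [CharP k p]
    (hk : Function.Bijective fun x : k => x ^ p) (r : ℕ)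
    (σ : MvPowerSeries (Fin r) (WittVector p k) →+*
      MvPowerSeries (Fin r) (WittVector p k))
    (hσp : ∀ a, σ a - a ^ p ∈
      Ideal.span {(p : MvPowerSeries (Fin r) (WittVector p k))})
    (hσJ : ∀ a ∈ Ideal.span (Set.range
        (MvPowerSeries.X : Fin r → MvPowerSeries (Fin r) (WittVector p k))),
      σ a ∈ Ideal.span (Set.range
        (MvPowerSeries.X : Fin r → MvPowerSeries (Fin r) (WittVector p k))))
    (E : MvPowerSeries (Fin r) (WittVector p k))
    (hE : E - (p : MvPowerSeries (Fin r) (WittVector p k)) ∈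
      Ideal.span (Set.range
        (MvPowerSeries.X : Fin r → MvPowerSeries (Fin r) (WittVector p k))))
    (δ : MvPowerSeries (Fin r) (WittVector p k) →+*
      WittVector p (MvPowerSeries (Fin r) (WittVector p k)))
    (hδ : ∀ (n : ℕ) (x : MvPowerSeries (Fin r) (WittVector p k)),
      WittVector.ghostComponent n (δ x) = (⇑σ)^[n] x) :
    ((WittVector.map (Ideal.Quotient.mk (Ideal.span {E})) (δ E)).coeff 0 = 0) ∧
    ∃ u : WittVector p (MvPowerSeries (Fin r) (WittVector p k) ⧸ Ideal.span {E}),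
      WittVector.verschiebung u =
        WittVector.map (Ideal.Quotient.mk (Ideal.span {E})) (δ E) ∧
      (∀ u' : WittVector p (MvPowerSeries (Fin r) (WittVector p k) ⧸ Ideal.span {E}),
        WittVector.verschiebung u' =
          WittVector.map (Ideal.Quotient.mk (Ideal.span {E})) (δ E) → u' = u) ∧
      IsUnit u ∧
      (∀ x : MvPowerSeries (Fin r) (WittVector p k),
        WittVector.map (Ideal.Quotient.mk (Ideal.span {E})) (δ (E * x)) =
          WittVector.verschiebung
            (u * WittVector.map (Ideal.Quotient.mk (Ideal.span {E})) (δ (σ x)))) := by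
  set π := Ideal.Quotient.mk (Ideal.span {E}) with hπ
  have hpW : (p : WittVector p k) ≠ 0 := p_nonzero p k
  have hpS : (p : MvPowerSeries (Fin r) (WittVector p k)) ≠ 0 := fun h => hpW <| by
    simpa using congrArg MvPowerSeries.constantCoeff h
  have hunitS (y : MvPowerSeries (Fin r) (WittVector p k)) : IsUnit (1 + p * y) := by
    rw [MvPowerSeries.isUnit_iff_constantCoeff]
    simpa using isUnit_one_add_p_mul (MvPowerSeries.constantCoeff y)
  have hcE : MvPowerSeries.constantCoeff E = p := by
    have h := MvPowerSeries.constantCoeff_eq_zero_of_mem_span_X hE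
    rwa [map_sub, map_natCast, sub_eq_zero] at h
  have hcσE : MvPowerSeries.constantCoeff (σ E) = p := by
    have h := MvPowerSeries.constantCoeff_eq_zero_of_mem_span_X (hσJ _ hE)
    rwa [map_sub, map_sub, map_natCast, map_natCast, sub_eq_zero] at h
  have hδ0 : (δ E).coeff 0 = E := by
    rw [← ghostComponent_zero_eq_coeff, hδ 0]
    rfl
  have hδ1 : IsUnit ((δ E).coeff 1) := by
    have h1 : E ^ p + p * (δ E).coeff 1 = σ E := by
      have h := hδ 1 E
      rw [ghostComponent_eq_sum] at h
      simpa [Finset.sum_range_succ, hδ0] using h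
    obtain ⟨m, hm⟩ : ∃ m, p = m + 2 := Nat.exists_eq_add_of_le' (Fact.out : p.Prime).two_le
    have h2 := congrArg MvPowerSeries.constantCoeff h1
    rw [map_add, map_pow, map_mul, map_natCast, hcE, hcσE] at h2
    rw [MvPowerSeries.isUnit_iff_constantCoeff]
    have h3 : MvPowerSeries.constantCoeff ((δ E).coeff 1) =
        1 + (p : WittVector p k) * (-(p : WittVector p k) ^ m) := by
      apply mul_left_cancel₀ hpW
      have hpow : (p : WittVector p k) ^ p = (p : WittVector p k) ^ (m + 2) := by rw [← hm]
      linear_combination h2 - hpow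
    rw [h3]
    exact isUnit_one_add_p_mul _
  have hfδ (x : MvPowerSeries (Fin r) (WittVector p k)) : frobenius (δ x) = δ (σ x) :=
    have := NoZeroDivisors.to_isDomain (MvPowerSeries (Fin r) (WittVector p k))
    ext_ghostComponent hpS fun n => by
      rw [ghostComponent_frobenius, hδ, hδ, Function.iterate_succ_apply]
  have h0 : (WittVector.map π (δ E)).coeff 0 = 0 := by
    rw [map_coeff, hδ0, hπ, Ideal.Quotient.eq_zero_iff_mem]
    exact Ideal.mem_span_singleton_self E
  have hv : verschiebung ((WittVector.map π (δ E)).shift 1) = WittVector.map π (δ E) :=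
    (eq_iterate_verschiebung (n := 1) fun i hi => by rwa [Nat.lt_one_iff.mp hi]).symm
  refine ⟨h0, (WittVector.map π (δ E)).shift 1, hv,
    fun u' hu' => verschiebung_injective p _ (hu'.trans hv.symm), ?_, fun x => ?_⟩
  · refine isUnit_of_isUnit_coeff_zero (fun y => ?_) ?_
    · obtain ⟨y, rfl⟩ := Ideal.Quotient.mk_surjective y
      simpa using (hunitS y).map π
    · rw [shift_coeff, map_coeff]
      exact hδ1.map π
  · have hfκ : WittVector.map π (δ (σ x)) = frobenius (WittVector.map π (δ x)) := by
      rw [← hfδ, (frobenius_isPoly p).map]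
    rw [hfκ, verschiebung_mul_frobenius, hv, map_mul, map_mul]
end

section
/- Let k be a perfect field of characteristic p, 𝔖 = W(k)[[x_1,…,x_r]], J ⊆ 𝔖 the ideal generated by the variables, and m = p·𝔖 + J the maximal ideal of 𝔖. Let σ : 𝔖 → 𝔖 be a ring endomorphism with σ(a) − a^p ∈ p·𝔖 for all a ∈ 𝔖 and σ(J) ⊆ J. Then for every n ≥ 0: (i) σ(m^n·J) ⊆ m^{n+1}·J; (ii) for every x ∈ m^n·J one has σ(x) − x^p ∈ p·(m^n·J); (iii) for all x, y ∈ m^n·J one has (σ(x+y) − (x+y)^p) − (σ(x) − x^p) − (σ(y) − y^p) ∈ p·(m^{2n+1}·J). -/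
namespace MvPowerSeries

variable {τ R : Type*} [CommRing R]

/-- A power series in finitely many variables without terms of degree at most `n` is a combination
of the variables whose coefficients have no terms of degree less than `n`. -/
theorem exists_eq_sum_X_mul [Fintype τ] {n : ℕ} {f : MvPowerSeries τ R}
    (hf : ((n + 1 : ℕ) : ℕ∞) ≤ f.order) :
    ∃ g : τ → MvPowerSeries τ R, (∀ i, (n : ℕ∞) ≤ (g i).order) ∧ f = ∑ i, X i * g i := by
  classical
  have key : ∀ d : τ →₀ ℕ, ∃ o : Option τ, d ≠ 0 → ∃ i, o = some i ∧ d i ≠ 0 := by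
    intro d
    by_cases hd : d = 0
    · exact ⟨none, fun h => absurd hd h⟩
    · obtain ⟨i, hi⟩ := Finsupp.ne_iff.mp hd
      exact ⟨some i, fun _ => ⟨i, rfl, hi⟩⟩
  choose c hc using key
  let g : τ → MvPowerSeries τ R := fun i d =>
    if c (d + Finsupp.single i 1) = some i then coeff (d + Finsupp.single i 1) f else 0
  have hg : ∀ i d, coeff d (g i) =
      if c (d + Finsupp.single i 1) = some i then coeff (d + Finsupp.single i 1) f else 0 :=
    fun _ _ => rfl
  refine ⟨g, fun i => nat_le_order fun d hd => ?_, ?_⟩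
  · rw [hg]
    split_ifs with h
    · refine coeff_of_lt_order (lt_of_lt_of_le ?_ hf)
      rw [map_add, Finsupp.degree_single]
      exact_mod_cast Nat.add_lt_add_right hd 1
    · rfl
  · ext d
    simp only [map_sum, X, coeff_monomial_mul, one_mul]
    by_cases hd : d = 0
    · subst hd
      rw [coeff_of_lt_order (lt_of_lt_of_le (by simp) hf)]
      refine (Finset.sum_eq_zero fun i _ => if_neg fun h => ?_).symm
      simpa using h i
    · obtain ⟨i, hci, hi⟩ := hc d hd
      have hle : Finsupp.single i 1 ≤ d := by
        simpa [Finsupp.single_le_iff] using Nat.one_le_iff_ne_zero.mpr hi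
      rw [Finset.sum_eq_single i]
      · rw [if_pos hle, hg, tsub_add_cancel_of_le hle, if_pos hci]
      · intro j _ hj
        split_ifs with h
        · rw [hg, tsub_add_cancel_of_le h, if_neg]
          rw [hci]
          simpa using hj.symm
        · rfl
      · simp

/-- The `n`-th power of the ideal of the variables consists of the power series of order at
least `n`. -/
theorem mem_span_range_X_pow_iff [Fintype τ] {n : ℕ} {f : MvPowerSeries τ R} :
    f ∈ Ideal.span (Set.range (X : τ → MvPowerSeries τ R)) ^ n ↔ (n : ℕ∞) ≤ f.order := by
  constructor
  · let I : ℕ → Ideal (MvPowerSeries τ R) := fun n =>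
      { carrier := {f | (n : ℕ∞) ≤ f.order}
        add_mem' := fun ha hb => le_trans (le_min ha hb) min_order_le_add
        zero_mem' := by simp
        smul_mem' := fun a b hb => le_trans (le_trans hb le_add_self) le_order_mul }
    suffices h : Ideal.span (Set.range (X : τ → MvPowerSeries τ R)) ^ n ≤ I n from fun hf => h hf
    induction n with
    | zero => exact fun f _ => by simp [I]
    | succ n ih =>
      rw [pow_succ, Ideal.mul_le]
      intro a ha b hb
      have h1 : Ideal.span (Set.range (X : τ → MvPowerSeries τ R)) ≤ I 1 := by
        rw [Ideal.span_le]
        rintro _ ⟨i, rfl⟩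
        change ((1 : ℕ) : ℕ∞) ≤ order (X i)
        rw [Nat.cast_one, one_le_order_iff_constCoeff_eq_zero, constantCoeff_X]
      change ((n + 1 : ℕ) : ℕ∞) ≤ (a * b).order
      rw [Nat.cast_add]
      exact (add_le_add (ih ha) (h1 hb)).trans le_order_mul
  · induction n generalizing f with
    | zero => simp
    | succ n ih =>
      intro hf
      obtain ⟨g, hg, rfl⟩ := exists_eq_sum_X_mul hf
      rw [pow_succ']
      exact Ideal.sum_mem _ fun i _ =>
        Ideal.mul_mem_mul (Ideal.subset_span ⟨i, rfl⟩) (ih (hg i))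

/-- A non-zero-divisor of the coefficient ring stays one modulo the powers of the ideal of the
variables. -/
theorem mem_span_range_X_pow_of_C_mul_mem [Fintype τ] [IsDomain R] {a : R} (ha : a ≠ 0) {n : ℕ}
    {f : MvPowerSeries τ R}
    (h : C a * f ∈ Ideal.span (Set.range (X : τ → MvPowerSeries τ R)) ^ n) :
    f ∈ Ideal.span (Set.range (X : τ → MvPowerSeries τ R)) ^ n := by
  rw [mem_span_range_X_pow_iff] at h ⊢
  refine nat_le_order fun d hd => ?_
  have h0 := coeff_of_lt_order (lt_of_lt_of_le (Nat.cast_lt.mpr hd) h)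
  rw [coeff_C_mul] at h0
  exact (mul_eq_zero.mp h0).resolve_left ha

end MvPowerSeries

namespace Ideal

variable {S : Type*} [CommRing S]

theorem span_singleton_sup_pow_succ_le (a : S) (J : Ideal S) (n : ℕ) :
    (span {a} ⊔ J) ^ (n + 1) ≤ span {a} * (span {a} ⊔ J) ^ n ⊔ J ^ (n + 1) := by
  induction n with
  | zero => simp
  | succ n ih =>
    set m := span {a} ⊔ J
    calc m ^ (n + 2) = span {a} * m ^ (n + 1) ⊔ J * m ^ (n + 1) := by
          rw [pow_succ' m (n + 1), ← Ideal.sup_mul]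
      _ ≤ span {a} * m ^ (n + 1) ⊔ J ^ (n + 2) := by
          refine sup_le le_sup_left ((mul_mono_right ih).trans ?_)
          rw [Ideal.mul_sup, ← pow_succ', mul_left_comm]
          refine sup_le_sup_right (mul_mono_right ?_) _
          rw [pow_succ']
          exact mul_mono_left le_sup_right

/-- If `a` is a non-zero-divisor, also modulo each power of `J`, then dividing by `a` lowers the
`(a, J)`-adic filtration on `J` by at most one. -/
theorem mem_pow_mul_of_mul_mem {a : S} {J : Ideal S}
    (hJ : ∀ n f, a * f ∈ J ^ n → f ∈ J ^ n) {n : ℕ} {f : S}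
    (h : a * f ∈ (span {a} ⊔ J) ^ (n + 1) * J) : f ∈ (span {a} ⊔ J) ^ n * J := by
  have h1 := mul_mono_left (K := J) (span_singleton_sup_pow_succ_le a J n) h
  rw [Ideal.sup_mul, mul_assoc, ← pow_succ, Submodule.mem_sup] at h1
  obtain ⟨u, hu, w, hw, huw⟩ := h1
  obtain ⟨z, hz, rfl⟩ := mem_span_singleton_mul.mp hu
  have h2 : f - z ∈ J ^ (n + 1 + 1) := hJ _ _ (by
    rw [mul_sub, ← huw, add_sub_cancel_left]
    exact hw)
  have h3 : f - z ∈ (span {a} ⊔ J) ^ n * J :=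
    mul_mono_left (pow_right_mono le_sup_right n) (by
      rw [← pow_succ]
      exact pow_le_pow_right (Nat.le_succ _) h2)
  simpa using add_mem h3 hz

theorem pow_mul_mul_pow_mul_le {m J : Ideal S} (h : J ≤ m) (n : ℕ) :
    (m ^ n * J) * (m ^ n * J) ≤ m ^ (2 * n + 1) * J := by
  calc (m ^ n * J) * (m ^ n * J) = m ^ (2 * n) * J * J := by ring
    _ ≤ m ^ (2 * n) * m * J := mul_mono_left (mul_mono_right h)
    _ = m ^ (2 * n + 1) * J := by rw [pow_succ]

end Ideal

/-- Let `𝔖 = W(k)[[x_1,…,x_r]]`, `J` the ideal of the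
variables, `m = p𝔖 + J` the maximal ideal, and `σ` a Frobenius lift with
`σ(J) ⊆ J`.  Then for every `n`: (i) `σ(m^n·J) ⊆ m^{n+1}·J`; (ii) for
`x ∈ m^n·J`, `σ(x) − x^p ∈ p·(m^n·J)`; (iii) for `x, y ∈ m^n·J`,
`(σ(x+y) − (x+y)^p) − (σ(x) − x^p) − (σ(y) − y^p) ∈ p·(m^{2n+1}·J)`. -/
theorem frobenius_lift_tau_graded (p : ℕ) [Fact p.Prime]
    (k : Type*) [Field k] [CharP k p]
    (hk : Function.Bijective fun x : k => x ^ p) (r : ℕ)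
    (J : Ideal (MvPowerSeries (Fin r) (WittVector p k)))
    (hJ : J = Ideal.span (Set.range
      (MvPowerSeries.X : Fin r → MvPowerSeries (Fin r) (WittVector p k))))
    (m : Ideal (MvPowerSeries (Fin r) (WittVector p k)))
    (hm : m = Ideal.span {(p : MvPowerSeries (Fin r) (WittVector p k))} ⊔ J)
    (σ : MvPowerSeries (Fin r) (WittVector p k) →+*
      MvPowerSeries (Fin r) (WittVector p k))
    (hσp : ∀ a, σ a - a ^ p ∈
      Ideal.span {(p : MvPowerSeries (Fin r) (WittVector p k))})
    (hσJ : ∀ a ∈ J, σ a ∈ J) (n : ℕ) :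
    (∀ x ∈ m ^ n * J, σ x ∈ m ^ (n + 1) * J) ∧
    (∀ x ∈ m ^ n * J, ∃ y ∈ m ^ n * J,
      σ x - x ^ p = (p : MvPowerSeries (Fin r) (WittVector p k)) * y) ∧
    (∀ x ∈ m ^ n * J, ∀ y ∈ m ^ n * J, ∃ z ∈ m ^ (2 * n + 1) * J,
      (σ (x + y) - (x + y) ^ p) - (σ x - x ^ p) - (σ y - y ^ p) =
        (p : MvPowerSeries (Fin r) (WittVector p k)) * z) := by
  have hp : p.Prime := Fact.out
  have hreg : ∀ n f, (p : MvPowerSeries (Fin r) (WittVector p k)) * f ∈ J ^ n → f ∈ J ^ n := by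
    intro n f h
    rw [hJ] at h ⊢
    refine MvPowerSeries.mem_span_range_X_pow_of_C_mul_mem (WittVector.p_nonzero p k) ?_
    rwa [map_natCast]
  have hJm : J ≤ m := hm ▸ le_sup_right
  have hpow : ∀ {n x}, x ∈ m ^ n * J → x ^ p ∈ m ^ (n + 1) * J := by
    intro n x hx
    obtain ⟨q, rfl⟩ := Nat.exists_eq_add_of_le' hp.two_le
    rw [pow_add x, sq]
    refine Ideal.mul_mem_left _ _ (Ideal.mul_mono_left (Ideal.pow_le_pow_right (by omega))
      (Ideal.pow_mul_mul_pow_mul_le hJm n (Ideal.mul_mem_mul hx hx)))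
  have hσJ' : J.map σ ≤ m * J := by
    rw [Ideal.map_le_iff_le_comap]
    intro x hx
    obtain ⟨y, hy⟩ := Ideal.mem_span_singleton.mp (hσp x)
    have hyJ : y ∈ J := by
      have := hreg 1 y (by
        rw [pow_one, ← hy]
        exact sub_mem (hσJ x hx) (J.pow_mem_of_mem hx p hp.pos))
      rwa [pow_one] at this
    have hpm : (p : MvPowerSeries (Fin r) (WittVector p k)) ∈ m :=
      hm ▸ Ideal.mem_sup_left (Ideal.mem_span_singleton_self _)
    have hxp : x ^ p ∈ m * J := by
      simpa using hpow (n := 0) (x := x) (by simpa using hx)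
    rw [Ideal.mem_comap, ← sub_add_cancel (σ x) (x ^ p), hy]
    exact add_mem (Ideal.mul_mem_mul hpm hyJ) hxp
  have hσm : m.map σ ≤ m := by
    rw [hm, Ideal.map_sup, ← hm]
    refine sup_le ?_ (hσJ'.trans Ideal.mul_le_left)
    rw [Ideal.map_span, Set.image_singleton, map_natCast, hm]
    exact le_sup_left
  have hσ : ∀ x ∈ m ^ n * J, σ x ∈ m ^ (n + 1) * J := by
    intro x hx
    have h := Ideal.mem_map_of_mem σ hx
    rw [Ideal.map_mul, Ideal.map_pow] at h
    rw [pow_succ, mul_assoc]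
    exact Ideal.mul_mono (Ideal.pow_right_mono hσm n) hσJ' h
  refine ⟨hσ, fun x hx => ?_, fun x hx y hy => ?_⟩
  · obtain ⟨y, hy⟩ := Ideal.mem_span_singleton.mp (hσp x)
    refine ⟨y, ?_, hy⟩
    have h : (p : MvPowerSeries (Fin r) (WittVector p k)) * y ∈ m ^ (n + 1) * J := by
      rw [← hy]
      exact sub_mem (hσ x hx) (hpow hx)
    rw [hm] at h ⊢
    exact Ideal.mem_pow_mul_of_mul_mem hreg h
  · obtain ⟨s, hs⟩ := exists_add_pow_prime_eq hp x y
    refine ⟨-(x * y * s), neg_mem (Ideal.mul_mem_right _ _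
      (Ideal.pow_mul_mul_pow_mul_le hJm n (Ideal.mul_mem_mul hx hy))), ?_⟩
    rw [hs, map_add]
    ring
end

section
/- Let p = 2 and let u_0 ∈ W(ℤ_2) be the unique element with v(u_0) = 2 − [2]. Then there exists a unique c ∈ W(ℤ_2) such that the image of c in W(F_2) under the map induced by the reduction ℤ_2 → F_2 equals 1 and u_0·f(c) = c; moreover this c is a unit of W(ℤ_2). -/
namespace WittVector

variable {p : ℕ} [Fact p.Prime]

theorem ghostComponent_map {R S : Type*} [CommRing R] [CommRing S] (f : R →+* S) (n : ℕ)
    (x : WittVector p R) : ghostComponent n (map f x) = f (ghostComponent n x) := by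
  simp [ghostComponent_apply, aeval_wittPolynomial]

theorem ghostMap_injective_padicInt :
    Function.Injective (ghostMap : WittVector p ℤ_[p] → ℕ → ℤ_[p]) := by
  intro x y h
  let _ : Invertible (p : ℚ_[p]) :=
    invertibleOfNonzero (Nat.cast_ne_zero.2 (Fact.out : p.Prime).ne_zero)
  apply map_injective (p := p) (PadicInt.Coe.ringHom (p := p)) Subtype.val_injective
  apply (ghostMap.bijective_of_invertible p ℚ_[p]).1
  ext n
  have hn := congrFun h n
  simp only [ghostMap_apply] at hn ⊢
  rw [ghostComponent_map, ghostComponent_map, hn]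

theorem map_toZMod_eq_zero_iff {x : WittVector p ℤ_[p]} :
    map (PadicInt.toZMod (p := p)) x = 0 ↔ ∀ n, (p : ℤ_[p]) ∣ x.coeff n := by
  rw [map_eq_zero_iff]
  refine forall_congr' fun n => ?_
  rw [← RingHom.mem_ker, PadicInt.ker_toZMod, PadicInt.maximalIdeal_eq_span_p,
    Ideal.mem_span_singleton]

/-- A Witt vector over `ℚ_[p]` whose `n`-th ghost component lies in `p ^ (n + 1) ℤ_[p]` for all `n`
has all its coefficients in `p ℤ_[p]`. -/
theorem exists_coeff_eq_p_mul (y : WittVector p ℚ_[p])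
    (hy : ∀ n, ∃ t : ℤ_[p], ghostComponent n y = (p : ℚ_[p]) ^ (n + 1) * t) (n : ℕ) :
    ∃ t : ℤ_[p], y.coeff n = p * t := by
  induction n using Nat.strong_induction_on with
  | _ n ih =>
  have hp : (p : ℚ_[p]) ≠ 0 := Nat.cast_ne_zero.2 (Fact.out : p.Prime).ne_zero
  have hsum : ∃ s : ℤ_[p], ∑ i ∈ Finset.range n, (p : ℚ_[p]) ^ i * y.coeff i ^ p ^ (n - i) =
      (p : ℚ_[p]) ^ (n + 1) * s := by
    have : ∀ i ∈ Finset.range n, ∃ s : ℤ_[p],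
        (p : ℚ_[p]) ^ i * y.coeff i ^ p ^ (n - i) = (p : ℚ_[p]) ^ (n + 1) * s := by
      intro i hi
      rw [Finset.mem_range] at hi
      obtain ⟨t, ht⟩ := ih i hi
      obtain ⟨k, hk⟩ := Nat.exists_eq_add_of_le
        (Nat.lt_pow_self (n := n - i) (Fact.out : p.Prime).one_lt).nat_succ_le
      refine ⟨p ^ k * t ^ p ^ (n - i), ?_⟩
      rw [ht, mul_pow]
      nth_rewrite 1 [hk]
      rw [show n + 1 = i + (n - i).succ by omega]
      push_cast
      ring
    choose! s hs using this
    refine ⟨∑ i ∈ Finset.range n, s i, ?_⟩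
    rw [Finset.sum_congr rfl hs, ← Finset.mul_sum]
    congr 1
    exact (map_sum (PadicInt.Coe.ringHom (p := p)) s _).symm
  obtain ⟨s, hs⟩ := hsum
  obtain ⟨t, ht⟩ := hy n
  rw [ghostComponent_apply, aeval_wittPolynomial, Finset.sum_range_succ, hs] at ht
  refine ⟨t - s, mul_left_cancel₀ (pow_ne_zero n hp) ?_⟩
  simp only [Nat.sub_self, pow_zero, pow_one] at ht
  push_cast
  linear_combination ht

theorem exists_ghostComponent_eq (e : ℕ → ℤ_[p]) (he : ∀ n, (p : ℤ_[p]) ^ (n + 1) ∣ e n) :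
    ∃ x : WittVector p ℤ_[p], map (PadicInt.toZMod (p := p)) x = 0 ∧
      ∀ n, ghostComponent n x = e n := by
  let _ : Invertible (p : ℚ_[p]) :=
    invertibleOfNonzero (Nat.cast_ne_zero.2 (Fact.out : p.Prime).ne_zero)
  obtain ⟨y, hy⟩ := (ghostMap.bijective_of_invertible p ℚ_[p]).2 fun n => (e n : ℚ_[p])
  have hy' : ∀ n, ghostComponent n y = (e n : ℚ_[p]) := fun n => congrFun hy n
  choose t ht using exists_coeff_eq_p_mul y fun n => by
    obtain ⟨t, ht⟩ := he n
    exact ⟨t, by rw [hy', ht]; push_cast; rfl⟩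
  have hx : map (PadicInt.Coe.ringHom (p := p)) (mk p fun n => p * t n) = y := by
    ext n
    rw [map_coeff, coeff_mk, ht, map_mul, map_natCast]
    rfl
  refine ⟨mk p fun n => p * t n, map_toZMod_eq_zero_iff.2 fun n => ⟨t n, by rw [coeff_mk]⟩,
    fun n => Subtype.val_injective ?_⟩
  rw [← hy', ← hx, ghostComponent_map]
  rfl

theorem pow_dvd_ghostComponent {x : WittVector p ℤ_[p]}
    (hx : map (PadicInt.toZMod (p := p)) x = 0) (n : ℕ) :
    (p : ℤ_[p]) ^ (n + 1) ∣ ghostComponent n x :=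
  pow_dvd_ghostComponent_of_dvd_coeff fun i _ => map_toZMod_eq_zero_iff.1 hx i

theorem pow_dvd_ghostComponent_sub_one {x : WittVector p ℤ_[p]}
    (hx : map (PadicInt.toZMod (p := p)) x = 1) (n : ℕ) :
    (p : ℤ_[p]) ^ (n + 1) ∣ ghostComponent n x - 1 := by
  rw [← map_one (ghostComponent (p := p) (R := ℤ_[p]) n), ← map_sub]
  exact pow_dvd_ghostComponent (by rw [map_sub, map_one, hx, sub_self]) n

theorem exists_ghostComponent_eq_of_sub_one (a : ℕ → ℤ_[p])
    (ha : ∀ n, (p : ℤ_[p]) ^ (n + 1) ∣ a n - 1) :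
    ∃ x : WittVector p ℤ_[p], map (PadicInt.toZMod (p := p)) x = 1 ∧
      ∀ n, ghostComponent n x = a n := by
  obtain ⟨x, hx, hxa⟩ := exists_ghostComponent_eq _ ha
  exact ⟨1 + x, by simp [hx], fun n => by simp [hxa]⟩

theorem isUnit_of_map_toZMod_eq_one {x : WittVector p ℤ_[p]}
    (hx : map (PadicInt.toZMod (p := p)) x = 1) : IsUnit x := by
  have hd := pow_dvd_ghostComponent_sub_one hx
  have hu : ∀ n, ∃ b, ghostComponent n x * b = 1 := fun n => by
    refine isUnit_iff_exists_inv.1 ?_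
    by_contra h
    have h1 := (PadicInt.norm_lt_one_iff_dvd _).1 (PadicInt.not_isUnit_iff.1 h)
    have h2 : (p : ℤ_[p]) ∣ 1 := by
      simpa using dvd_sub h1 ((dvd_pow_self _ n.succ_ne_zero).trans (hd n))
    exact PadicInt.prime_p.not_isUnit (isUnit_of_dvd_one h2)
  choose b hb using hu
  obtain ⟨y, -, hy⟩ := exists_ghostComponent_eq_of_sub_one b fun n => by
    obtain ⟨k, hk⟩ := hd n
    exact ⟨-k * b n, by linear_combination hb n - b n * hk⟩
  refine IsUnit.of_mul_eq_one y (ghostMap_injective_padicInt ?_)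
  ext n
  simp [hy, hb]

end WittVector

namespace PadicInt

variable {p : ℕ} [Fact p.Prime]

/-- If `g n ≡ 1` modulo `p ^ (n + 1)` for all `n`, then the tails `a n` of the infinite product of
`g` satisfy the same congruences and `a n = g n * a (n + 1)`. -/
theorem exists_telescoping_prod (g : ℕ → ℤ_[p]) (hg : ∀ n, (p : ℤ_[p]) ^ (n + 1) ∣ g n - 1) :
    ∃ a : ℕ → ℤ_[p], (∀ n, (p : ℤ_[p]) ^ (n + 1) ∣ a n - 1) ∧ ∀ n, a n = g n * a (n + 1) := by
  have hmem : ∀ (x : ℤ_[p]) (n : ℕ), (p : ℤ_[p]) ^ n ∣ x ↔ ‖x‖ ≤ (p : ℝ) ^ (-n : ℤ) := fun x n => by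
    rw [norm_le_pow_iff_mem_span_pow, Ideal.mem_span_singleton]
  have hp : 1 < (p : ℝ) := Nat.one_lt_cast.2 (Fact.out : p.Prime).one_lt
  have hsum : Summable fun n => ‖g n - 1‖ := by
    refine Summable.of_nonneg_of_le (fun _ => norm_nonneg _) (fun n => ?_)
      (summable_geometric_of_lt_one (inv_nonneg.2 (zero_le_one.trans hp.le))
        (inv_lt_one_of_one_lt₀ hp))
    have := (hmem _ n).1 ((pow_dvd_pow _ n.le_succ).trans (hg n))
    simpa using this
  have hmul : ∀ n, Multipliable fun k => g (k + n) := fun n => by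
    have h := multipliable_one_add_of_summable (f := fun k => g (k + n) - 1)
      ((summable_nat_add_iff (f := fun k => ‖g k - 1‖) n).2 hsum)
    simpa only [add_sub_cancel] using h
  refine ⟨fun n => ∏' k, g (k + n), fun n => ?_, fun n => ?_⟩
  · have hclosed : IsClosed {x : ℤ_[p] | (p : ℤ_[p]) ^ (n + 1) ∣ x - 1} := by
      simp_rw [hmem]
      exact isClosed_le (by fun_prop) continuous_const
    refine hclosed.mem_of_tendsto (hmul n).hasProd (.of_forall fun s => ?_)
    refine Finset.prod_induction _ (fun x : ℤ_[p] => (p : ℤ_[p]) ^ (n + 1) ∣ x - 1) ?_ (by simp) ?_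
    · rintro x y ⟨c, hc⟩ ⟨d, hd⟩
      exact ⟨c * y + d, by linear_combination y * hc + hd⟩
    · exact fun k _ => (pow_dvd_pow _ (by omega)).trans (hg (k + n))
  · have h := tprod_eq_zero_mul' (f := fun k => g (k + n))
      (by simpa only [add_right_comm, add_assoc] using hmul (n + 1))
    simpa [add_right_comm, add_assoc, add_comm 1] using h

end PadicInt

namespace WittVector

variable {p : ℕ} [Fact p.Prime]

theorem existsUnique_mul_frobenius_eq {u : WittVector p ℤ_[p]}
    (hu : map (PadicInt.toZMod (p := p)) u = 1) :
    ∃! c : WittVector p ℤ_[p], map (PadicInt.toZMod (p := p)) c = 1 ∧ u * frobenius c = c := by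
  obtain ⟨a, ha, hrec⟩ := PadicInt.exists_telescoping_prod _ (pow_dvd_ghostComponent_sub_one hu)
  obtain ⟨c, hc, hca⟩ := exists_ghostComponent_eq_of_sub_one a ha
  have hfix : u * frobenius c = c := by
    apply ghostMap_injective_padicInt
    ext n
    simp only [ghostMap_apply, map_mul, ghostComponent_frobenius, hca, ← hrec]
  refine ⟨c, ⟨hc, hfix⟩, fun d ⟨hd, hdfix⟩ => sub_eq_zero.1 ?_⟩
  have hmap : map (PadicInt.toZMod (p := p)) (d - c) = 0 := by rw [map_sub, hc, hd, sub_self]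
  have hsub : u * frobenius (d - c) = d - c := by rw [map_sub, mul_sub, hdfix, hfix]
  have hdvd : ∀ m n, ghostComponent (n + m) (d - c) ∣ ghostComponent n (d - c) := fun m => by
    induction m with
    | zero => exact fun n => dvd_rfl
    | succ m ih =>
      refine fun n => dvd_trans ?_ (ih n)
      refine ⟨ghostComponent (n + m) u, ?_⟩
      conv_lhs => rw [← hsub]
      rw [map_mul, ghostComponent_frobenius, mul_comm]
      rfl
  apply ghostMap_injective_padicInt
  ext1 n
  rw [map_zero, ghostMap_apply, Pi.zero_apply]
  by_contra hne
  refine (FiniteMultiplicity.of_prime_left PadicInt.prime_p hne).not_pow_dvd_of_multiplicity_lt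
    (Nat.lt_succ_self _) ((pow_dvd_pow _ ?_).trans
      ((pow_dvd_ghostComponent hmap _).trans
        (hdvd (multiplicity (p : ℤ_[p]) (ghostComponent n (d - c))) n)))
  omega

end WittVector


/-- Let `p = 2` and let `u₀ ∈ W(ℤ_2)` be the unique element
with `v(u₀) = 2 − [2]`.  Then there is a unique `c ∈ W(ℤ_2)` reducing to `1`
in `W(𝔽_2)` with `u₀·f(c) = c`, and this `c` is a unit. -/
theorem exists_unique_c_u0_frobenius_fixed
    (u₀ : WittVector 2 ℤ_[2])
    (hu₀ : WittVector.verschiebung u₀ =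
      (2 : WittVector 2 ℤ_[2]) - WittVector.teichmuller 2 (2 : ℤ_[2])) :
    (∃! c : WittVector 2 ℤ_[2],
      WittVector.map (PadicInt.toZMod (p := 2)) c = 1 ∧
      u₀ * WittVector.frobenius c = c) ∧
    (∀ c : WittVector 2 ℤ_[2],
      WittVector.map (PadicInt.toZMod (p := 2)) c = 1 →
      u₀ * WittVector.frobenius c = c → IsUnit c) := by
  have hu : WittVector.map (PadicInt.toZMod (p := 2)) u₀ = 1 := by
    apply WittVector.verschiebung_injective
    rw [← WittVector.map_verschiebung, hu₀, WittVector.verschiebung_zmod, map_sub,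
      WittVector.map_teichmuller]
    have h2 : PadicInt.toZMod (p := 2) 2 = 0 := by
      rw [map_ofNat]
      rfl
    simp [h2, map_ofNat (WittVector.map (PadicInt.toZMod (p := 2))) 2]
  exact ⟨WittVector.existsUnique_mul_frobenius_eq hu,
    fun c hc _ => WittVector.isUnit_of_map_toZMod_eq_one hc⟩
end
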